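/- Let 𝔄 be a subshift and c* a locally fundamental local rule of radius r* on 𝔄 valued in a discrete abelian group G*. If a ∈ 𝔄̃ has a projective H-pole for some discrete abelian group H (i.e., a has a projective c-pole for some H-valued local rule c on 𝔄), then a has a projective c*-pole. -/

import Mathlib

open scoped ENNReal

namespace Defects

/-- The configuration space `A^(ℤ^D)`. -/
abbrev Config (D : ℕ) (A : Type) := (Fin D → ℤ) → A

variable {D : ℕ} {A : Type}

/-- The shift `σ^v`. -/
def shift (v : Fin D → ℤ) (a : Config D A) : Config D A := fun z => a (z + v)

/-- A subshift: a nonempty closed shift-invariant subset of `A^(ℤ^D)`. -/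
def IsSubshift [TopologicalSpace A] (𝔄 : Set (Config D A)) : Prop :=
  𝔄.Nonempty ∧ IsClosed 𝔄 ∧ ∀ v : Fin D → ℤ, shift v '' 𝔄 = 𝔄

/-- The cube `B(r) = [-r, r]^D ⊆ ℤ^D`. -/
def ballZ (D r : ℕ) : Set (Fin D → ℤ) := {w | ∀ i, |w i| ≤ (r : ℤ)}

/-- The `r`-block of `a` at `z`, as an element of `A^(B(r))`. -/
def blockAt (r : ℕ) (a : Config D A) (z : Fin D → ℤ) : ballZ D r → A :=
  fun w => a (z + w.1)

/-- The set `𝔄_(r)` of admissible `r`-blocks. -/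
def admissibleBlocks (𝔄 : Set (Config D A)) (r : ℕ) : Set (ballZ D r → A) :=
  (fun a => blockAt r a 0) '' 𝔄

/-- `G_R(a)`: the set of `z` where the `R`-block of `a` is admissible. -/
def goodSet (𝔄 : Set (Config D A)) (R : ℕ) (a : Config D A) : Set (Fin D → ℤ) :=
  {z | blockAt R a z ∈ admissibleBlocks 𝔄 R}

/-- `𝔄̃`: configurations having arbitrarily large admissible regions. -/
def almostAdmissible (𝔄 : Set (Config D A)) : Set (Config D A) :=
  {a | ∀ R : ℕ, (goodSet 𝔄 R a).Nonempty}

/-- The defect of `a` is removable if some `a' ∈ 𝔄` agrees with `a` on `G_r(a)`. -/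
def Removable (𝔄 : Set (Config D A)) (a : Config D A) : Prop :=
  ∃ r : ℕ, ∃ a' ∈ 𝔄, ∀ z ∈ goodSet 𝔄 r a, a' z = a z

/-- A cellular automaton: continuous and commuting with all shifts. -/
def IsCellularAutomaton [TopologicalSpace A] (Φ : Config D A → Config D A) : Prop :=
  Continuous Φ ∧ ∀ v : Fin D → ℤ, Φ ∘ shift v = shift v ∘ Φ

/-- `Φ` has radius `R`: `Φ(a)(z)` depends only on the `R`-block of `a` at `z`. -/
def HasRadius {B : Type} (Φ : Config D A → Config D B) (R : ℕ) : Prop :=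
  ∀ a b : Config D A, ∀ z : Fin D → ℤ, blockAt R a z = blockAt R b z → Φ a z = Φ b z

/-- `E = {±e_1, …, ±e_D}`. -/
def stdSteps (D : ℕ) : Set (Fin D → ℤ) :=
  {v | ∃ i : Fin D, v = Pi.single i 1 ∨ v = -Pi.single i 1}

/-- A subshift homomorphism `Φ : 𝔄 → 𝔅`. -/
def IsSubshiftHom {B : Type} [TopologicalSpace A] [TopologicalSpace B]
    (𝔄 : Set (Config D A)) (𝔅 : Set (Config D B)) (Φ : Config D A → Config D B) : Prop :=
  Set.MapsTo Φ 𝔄 𝔅 ∧ ContinuousOn Φ 𝔄 ∧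
    ∀ v : Fin D → ℤ, ∀ a ∈ 𝔄, Φ (shift v a) = shift v (Φ a)

/-- `Φ` has radius `R` as a map on `𝔄`. -/
def HomHasRadius {B : Type} (𝔄 : Set (Config D A)) (Φ : Config D A → Config D B)
    (R : ℕ) : Prop :=
  ∀ a ∈ 𝔄, ∀ a' ∈ 𝔄, ∀ z : Fin D → ℤ, blockAt R a z = blockAt R a' z → Φ a z = Φ a' z

/-! ### Dynamical cocycles (multiplicative) -/

/-- A continuous `G`-valued (dynamical) cocycle on `𝔄`. -/
def DynCocycleOn [TopologicalSpace A] {G : Type} [Group G] [TopologicalSpace G] (𝔄 : Set (Config D A))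
    (C : (Fin D → ℤ) → Config D A → G) : Prop :=
  (∀ z : Fin D → ℤ, ContinuousOn (C z) 𝔄) ∧
    ∀ y z : Fin D → ℤ, ∀ a ∈ 𝔄, C (y + z) a = C y (shift z a) * C z a

/-- Cohomologous cocycles, via a continuous transfer function. -/
def DynCohomologous [TopologicalSpace A] {G : Type} [Group G] [TopologicalSpace G] (𝔄 : Set (Config D A))
    (C C' : (Fin D → ℤ) → Config D A → G) : Prop :=
  ∃ b : Config D A → G, ContinuousOn b 𝔄 ∧
    ∀ z : Fin D → ℤ, ∀ a ∈ 𝔄, C' z a = b (shift z a) * C z a * (b a)⁻¹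

/-- A trivial cocycle: cohomologous to a homomorphism `ℤ^D → G`. -/
def DynTrivial [TopologicalSpace A] {G : Type} [Group G] [TopologicalSpace G] (𝔄 : Set (Config D A))
    (C : (Fin D → ℤ) → Config D A → G) : Prop :=
  ∃ h : (Fin D → ℤ) → G, (∀ y z : Fin D → ℤ, h (y + z) = h y * h z) ∧
    DynCohomologous 𝔄 C (fun z _ => h z)

/-- A cocycle is locally determined with radius `r` if `C(e, ·)` (for `e ∈ E`)
depends only on the `r`-block at `0`. -/
def LocallyDetermined {G : Type} [Group G] (𝔅 : Set (Config D A))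
    (C : (Fin D → ℤ) → Config D A → G) (r : ℕ) : Prop :=
  ∀ e ∈ stdSteps D, ∀ b ∈ 𝔅, ∀ b' ∈ 𝔅,
    blockAt r b 0 = blockAt r b' 0 → C e b = C e b'

/-- A fundamental cocycle: every continuous cocycle into a discrete group is
cohomologous to a homomorphic image of `Cstar`. -/
def IsFundamental [TopologicalSpace A] {Gs : Type} [Group Gs] [TopologicalSpace Gs] (𝔄 : Set (Config D A))
    (Cstar : (Fin D → ℤ) → Config D A → Gs) : Prop :=
  ∀ (H : Type) [Group H] [TopologicalSpace H] [DiscreteTopology H],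
    ∀ C : (Fin D → ℤ) → Config D A → H,
      DynCocycleOn 𝔄 C → ∃ ψ : Gs →* H, DynCohomologous 𝔄 C fun z a => ψ (Cstar z a)


/-! ### Trails and locally determined cocycles via local rules -/

/-- A trail: a nonempty sequence in `ℤ^D` whose successive steps lie in `E`. -/
def IsTrail (ζ : List (Fin D → ℤ)) : Prop :=
  ζ ≠ [] ∧ ζ.Chain' fun x y => y - x ∈ stdSteps D

/-- The trail `ζ` lies in `Y`. -/
def TrailIn (Y : Set (Fin D → ℤ)) (ζ : List (Fin D → ℤ)) : Prop := ∀ z ∈ ζ, z ∈ Y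

/-- A closed trail: the first and last points coincide. -/
def IsClosedTrail (ζ : List (Fin D → ℤ)) : Prop := ζ.head? = ζ.getLast?

/-- Concatenation of trails (the final point of `ζ` should equal the initial
point of `ξ`). -/
def trailConcat (ζ ξ : List (Fin D → ℤ)) : List (Fin D → ℤ) := ζ ++ ξ.tail

/-- The value `c(ζ, a)` of a local rule along a trail, later steps multiplied
on the left. -/
def trailVal {G : Type} [Group G] {r : ℕ} (c : (Fin D → ℤ) → (ballZ D r → A) → G)
    (a : Config D A) : List (Fin D → ℤ) → G
  | [] => 1
  | [_] => 1
  | x :: y :: rest => trailVal c a (y :: rest) * c (y - x) (blockAt r a x)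

/-- A local rule of radius `r` for a `G`-valued cocycle on `𝔄`. -/
def IsLocalRule {G : Type} [Group G] (𝔄 : Set (Config D A)) (r : ℕ)
    (c : (Fin D → ℤ) → (ballZ D r → A) → G) : Prop :=
  ∀ a : Config D A, ∀ e ∈ stdSteps D, ∀ e' ∈ stdSteps D,
    ((0 ∈ goodSet 𝔄 r a ∧ e ∈ goodSet 𝔄 r a ∧ e' ∈ goodSet 𝔄 r a ∧
        e + e' ∈ goodSet 𝔄 r a) →
      c e' (blockAt r a e) * c e (blockAt r a 0) =
        c e (blockAt r a e') * c e' (blockAt r a 0)) ∧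
    ((0 ∈ goodSet 𝔄 r a ∧ e ∈ goodSet 𝔄 r a) →
      c (-e) (blockAt r a e) = (c e (blockAt r a 0))⁻¹)

/-- Elementary `Y`-homotopies of trails. -/
inductive ElemHomotopy (Y : Set (Fin D → ℤ)) :
    List (Fin D → ℤ) → List (Fin D → ℤ) → Prop
  | slide (pre post : List (Fin D → ℤ)) (x y z : Fin D → ℤ)
      (hxy : y - x ∈ stdSteps D) (hyz : z - y ∈ stdSteps D) (hw : x + z - y ∈ Y) :
      ElemHomotopy Y (pre ++ x :: y :: z :: post) (pre ++ x :: (x + z - y) :: z :: post)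
  | delBacktrack (pre post : List (Fin D → ℤ)) (x y : Fin D → ℤ)
      (hstep : y - x ∈ stdSteps D) :
      ElemHomotopy Y (pre ++ x :: y :: x :: post) (pre ++ x :: post)
  | insBacktrack (pre post : List (Fin D → ℤ)) (x y : Fin D → ℤ)
      (hy : y ∈ Y) (hstep : y - x ∈ stdSteps D) :
      ElemHomotopy Y (pre ++ x :: post) (pre ++ x :: y :: x :: post)

/-- Two trails are `Y`-homotopic if joined by a finite chain of elementary
`Y`-homotopies. -/
def TrailHomotopic (Y : Set (Fin D → ℤ)) : List (Fin D → ℤ) → List (Fin D → ℤ) → Prop :=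
  Relation.ReflTransGen fun p q => ElemHomotopy Y p q ∨ ElemHomotopy Y q p

/-- Points `z`, `y` joined by a trail lying in `Y`. -/
def TrailConnIn (Y : Set (Fin D → ℤ)) (z y : Fin D → ℤ) : Prop :=
  ∃ (ζ : List (Fin D → ℤ)) (h : ζ ≠ []),
    IsTrail ζ ∧ TrailIn Y ζ ∧ ζ.head h = z ∧ ζ.getLast h = y

/-- `a` has a projective `c`-pole: for every `R ≥ r` there is a closed trail in
`G_R(a)` with nontrivial value. -/
def HasProjPole {G : Type} [Group G] (𝔄 : Set (Config D A)) (r : ℕ)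
    (c : (Fin D → ℤ) → (ballZ D r → A) → G) (a : Config D A) : Prop :=
  ∀ R : ℕ, r ≤ R → ∃ ζ : List (Fin D → ℤ),
    IsTrail ζ ∧ IsClosedTrail ζ ∧ TrailIn (goodSet 𝔄 R a) ζ ∧ trailVal c a ζ ≠ 1

/-- Restriction of a `ρ`-block to an `r`-block (`r ≤ ρ`). -/
def restrictBlock {r ρ : ℕ} (h : r ≤ ρ) (p : ballZ D ρ → A) : ballZ D r → A :=
  fun w => p ⟨w.1, by
    intro i
    exact le_trans (w.2 i) (by exact_mod_cast h)⟩

/-- The lift of a local rule of radius `r` to radius `ρ ≥ r`. -/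
def liftRule {G : Type} [Group G] {r ρ : ℕ} (h : r ≤ ρ)
    (c : (Fin D → ℤ) → (ballZ D r → A) → G) :
    (Fin D → ℤ) → (ballZ D ρ → A) → G :=
  fun e p => c e (restrictBlock h p)

/-- Local rules of radius `ρ` are locally cohomologous via a local transfer
function of some radius `s ≤ ρ`. -/
def LocallyCohomologous {G : Type} [Group G] (𝔄 : Set (Config D A)) (ρ : ℕ)
    (c₁ c₂ : (Fin D → ℤ) → (ballZ D ρ → A) → G) : Prop :=
  ∃ (s : ℕ) (_ : s ≤ ρ) (b : (ballZ D s → A) → G),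
    ∀ a : Config D A, ∀ e ∈ stdSteps D,
      (0 ∈ goodSet 𝔄 ρ a ∧ e ∈ goodSet 𝔄 ρ a) →
      c₂ e (blockAt ρ a 0) = b (blockAt s a e) * c₁ e (blockAt ρ a 0) *
        (b (blockAt s a 0))⁻¹

/-- Extend a block to a configuration (arbitrarily outside the block). -/
noncomputable def blockExtend [Nonempty A] {ρ : ℕ} (p : ballZ D ρ → A) : Config D A :=
  fun z => @dite A (z ∈ ballZ D ρ) (Classical.propDecidable _)
    (fun h => p ⟨z, h⟩) (fun _ => Classical.arbitrary A)

/-- The block map `Φ̄ : 𝔄_(r+R) → 𝔄_(r)` induced by a CA `Φ` of radius `R`. -/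
noncomputable def blockMapCA [Nonempty A] (Φ : Config D A → Config D A) (R r : ℕ)
    (p : ballZ D (r + R) → A) : ballZ D r → A :=
  blockAt r (Φ (blockExtend p)) 0

/-- The pullback local rule `Φ_* c` of radius `r + R`. -/
noncomputable def pullRule [Nonempty A] {G : Type} [Group G]
    (Φ : Config D A → Config D A) (R r : ℕ)
    (c : (Fin D → ℤ) → (ballZ D r → A) → G) :
    (Fin D → ℤ) → (ballZ D (r + R) → A) → G :=
  fun e p => c e (blockMapCA Φ R r p)

/-- Two local rules (of radii `r₁`, `r₂`) define the same class in
`H¹_loc(𝔄, G)`. -/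
def SameHlocClass {G : Type} [CommGroup G] (𝔄 : Set (Config D A)) {r₁ r₂ : ℕ}
    (c₁ : (Fin D → ℤ) → (ballZ D r₁ → A) → G)
    (c₂ : (Fin D → ℤ) → (ballZ D r₂ → A) → G) : Prop :=
  ∃ (ρ : ℕ) (h₁ : r₁ ≤ ρ) (h₂ : r₂ ≤ ρ) (h : (Fin D → ℤ) → G),
    (∀ y z : Fin D → ℤ, h (y + z) = h y * h z) ∧
    LocallyCohomologous 𝔄 ρ (liftRule h₁ c₁) fun e p => liftRule h₂ c₂ e p * h e

/-- `a` has a projective `G`-pole: a projective `c`-pole for some `G`-valued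
local rule `c` of some radius. -/
def HasProjGPole (G : Type) [Group G] (𝔄 : Set (Config D A)) (a : Config D A) : Prop :=
  ∃ (r : ℕ) (c : (Fin D → ℤ) → (ballZ D r → A) → G),
    IsLocalRule 𝔄 r c ∧ HasProjPole 𝔄 r c a

/-- A locally fundamental local rule (valued in a discrete abelian group). -/
def IsLocallyFundamental {Gs : Type} [CommGroup Gs] (𝔄 : Set (Config D A)) (rstar : ℕ)
    (cstar : (Fin D → ℤ) → (ballZ D rstar → A) → Gs) : Prop :=
  ∀ (H : Type) [CommGroup H], ∀ (r : ℕ) (c : (Fin D → ℤ) → (ballZ D r → A) → H),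
    IsLocalRule 𝔄 r c →
    ∃ (ψ : Gs →* H) (ρ : ℕ) (h₁ : rstar ≤ ρ) (h₂ : r ≤ ρ),
      LocallyCohomologous 𝔄 ρ (liftRule h₁ fun e p => ψ (cstar e p)) (liftRule h₂ c)

/-- A pseudonorm on `G`, with values in `[0, ∞]`. -/
def IsPseudonorm {G : Type} [Group G] (ν : G → ℝ≥0∞) : Prop :=
  ν 1 = 0 ∧ (∀ g h : G, ν (g * h) = ν (h * g)) ∧ ∀ g h : G, ν (g * h) ≤ ν g + ν h

/-- The `ℓ¹`-norm on `ℤ^D`. -/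
def l1norm {D : ℕ} (v : Fin D → ℤ) : ℕ := ∑ i, (v i).natAbs


/-! ### Additive dynamical and equivariant cocycles -/

/-- A continuous `(G,+)`-valued dynamical cocycle on `𝔄`. -/
def AddDynCocycleOn [TopologicalSpace A] {G : Type} [AddCommGroup G] [TopologicalSpace G]
    (𝔄 : Set (Config D A)) (C : (Fin D → ℤ) → Config D A → G) : Prop :=
  (∀ z : Fin D → ℤ, ContinuousOn (C z) 𝔄) ∧
    ∀ y z : Fin D → ℤ, ∀ a ∈ 𝔄, C (y + z) a = C y (shift z a) + C z a

/-- Cohomologous additive cocycles. -/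
def AddDynCohomologous [TopologicalSpace A] {G : Type} [AddCommGroup G] [TopologicalSpace G]
    (𝔄 : Set (Config D A)) (C C' : (Fin D → ℤ) → Config D A → G) : Prop :=
  ∃ b : Config D A → G, ContinuousOn b 𝔄 ∧
    ∀ z : Fin D → ℤ, ∀ a ∈ 𝔄, C' z a = b (shift z a) + C z a - b a

/-- The equivariant edge cocycle `Ψ(C̃)(x→y; a) = C̃(y−x, σ^x(a))` associated to a
dynamical cocycle. -/
def edgeCocycleOf {G : Type} [AddCommGroup G] (C : (Fin D → ℤ) → Config D A → G) :
    (Fin D → ℤ) → (Fin D → ℤ) → Config D A → G :=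
  fun x y a => C (y - x) (shift x a)

/-- A continuous equivariant 1-cocycle on `𝔄` (as a function of oriented edges
`x → y`, i.e. pairs with `y - x ∈ E`). -/
def IsEqCocycle [TopologicalSpace A] {G : Type} [AddCommGroup G] [TopologicalSpace G]
    (𝔄 : Set (Config D A)) (C : (Fin D → ℤ) → (Fin D → ℤ) → Config D A → G) : Prop :=
  (∀ x y : Fin D → ℤ, y - x ∈ stdSteps D → ContinuousOn (C x y) 𝔄) ∧
  (∀ x y z : Fin D → ℤ, y - x ∈ stdSteps D → ∀ a ∈ 𝔄,
      C x y (shift z a) = C (x + z) (y + z) a) ∧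
  (∀ x y : Fin D → ℤ, y - x ∈ stdSteps D → ∀ a ∈ 𝔄, C y x a = -C x y a) ∧
  (∀ s : Fin D → ℤ, ∀ i j : Fin D, i ≠ j → ∀ a ∈ 𝔄,
      C s (s + Pi.single i 1) a +
        C (s + Pi.single i 1) (s + Pi.single i 1 + Pi.single j 1) a =
      C s (s + Pi.single j 1) a +
        C (s + Pi.single j 1) (s + Pi.single i 1 + Pi.single j 1) a)

/-- Cohomologous equivariant 1-cocycles, via an equivariant continuous
0-cochain `B`. -/
def EqCohomologous [TopologicalSpace A] {G : Type} [AddCommGroup G] [TopologicalSpace G]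
    (𝔄 : Set (Config D A)) (C C' : (Fin D → ℤ) → (Fin D → ℤ) → Config D A → G) : Prop :=
  ∃ B : (Fin D → ℤ) → Config D A → G,
    (∀ x : Fin D → ℤ, ContinuousOn (B x) 𝔄) ∧
    (∀ x z : Fin D → ℤ, ∀ a ∈ 𝔄, B x (shift z a) = B (x + z) a) ∧
    ∀ x y : Fin D → ℤ, y - x ∈ stdSteps D → ∀ a ∈ 𝔄,
      C' x y a = B y a + C x y a - B x a

/-! ### Cells, chains, and equivariant `d`-cocycles -/

/-- A cell in `ℤ^D`: a base point together with a set of spanning directions. -/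
abbrev Cell (D : ℕ) := (Fin D → ℤ) × Finset (Fin D)

/-- Chains: finitely supported `ℤ`-valued functions on cells. -/
abbrev CellChain (D : ℕ) := Cell D →₀ ℤ

/-- The boundary of a single cell. -/
noncomputable def cellBoundary {D : ℕ} (cell : Cell D) : CellChain D :=
  ∑ i ∈ cell.2, ((-1 : ℤ) ^ (cell.2.filter fun j => j < i).card) •
    (Finsupp.single (cell.1 + Pi.single i 1, cell.2.erase i) (1 : ℤ) -
      Finsupp.single (cell.1, cell.2.erase i) (1 : ℤ))

/-- The boundary homomorphism on chains. -/
noncomputable def chainBoundary {D : ℕ} (ζ : CellChain D) : CellChain D :=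
  ζ.sum fun cell n => n • cellBoundary cell

/-- The value of an equivariant cochain (of radius `r`) on a chain. -/
def chainVal {G : Type} [AddCommGroup G] {r : ℕ}
    (c : Finset (Fin D) → (ballZ D r → A) → G) (a : Config D A) (ζ : CellChain D) : G :=
  ζ.sum fun cell n => n • c cell.2 (blockAt r a cell.1)

/-- An equivariant `d`-cocycle of radius `r` on `𝔄`: vanishes on boundaries of
`(d+1)`-cells over admissible configurations. -/
def IsEqDCocycle {G : Type} [AddCommGroup G] (𝔄 : Set (Config D A)) (d r : ℕ)
    (c : Finset (Fin D) → (ballZ D r → A) → G) : Prop :=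
  ∀ a ∈ 𝔄, ∀ cell : Cell D, cell.2.card = d + 1 →
    chainVal c a (cellBoundary cell) = 0

/-- `a` has a projective `(G,d)`-pole. -/
def HasProjDPole (G : Type) [AddCommGroup G] (𝔄 : Set (Config D A)) (d : ℕ)
    (a : Config D A) : Prop :=
  ∃ (r : ℕ) (c : Finset (Fin D) → (ballZ D r → A) → G),
    IsEqDCocycle 𝔄 d r c ∧
    ∀ R : ℕ, r ≤ R → ∃ ζ : CellChain D,
      (∀ cell ∈ ζ.support, (cell : Cell D).2.card = d) ∧
      chainBoundary ζ = 0 ∧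
      (∀ cell ∈ ζ.support, (cell : Cell D).1 ∈ goodSet 𝔄 R a) ∧
      chainVal c a ζ ≠ 0


theorem goodSet_antitone (𝔄 : Set (Config D A)) (a : Config D A) :
    Antitone fun R => goodSet 𝔄 R a := by
  rintro r R h z ⟨a', ha', he⟩
  exact ⟨a', ha', congrArg (restrictBlock h) he⟩

theorem blockAt_shift (r : ℕ) (v : Fin D → ℤ) (a : Config D A) (z : Fin D → ℤ) :
    blockAt r (shift v a) z = blockAt r a (z + v) := by
  funext w
  simp only [blockAt, shift, add_right_comm]

theorem mem_goodSet_shift {𝔄 : Set (Config D A)} {R : ℕ} {v : Fin D → ℤ} {a : Config D A}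
    {z : Fin D → ℤ} : z ∈ goodSet 𝔄 R (shift v a) ↔ z + v ∈ goodSet 𝔄 R a := by
  simp only [goodSet, Set.mem_ofPred_eq, blockAt_shift]

/-- Lifting a local rule does not change trail values. -/
theorem trailVal_liftRule {G : Type} [Group G] {r ρ : ℕ} (h : r ≤ ρ)
    (c : (Fin D → ℤ) → (ballZ D r → A) → G) (a : Config D A) :
    ∀ ζ : List (Fin D → ℤ), trailVal (liftRule h c) a ζ = trailVal c a ζ
  | [] => rfl
  | [_] => rfl
  | x :: y :: l => congrArg (· * c (y - x) (blockAt r a x)) (trailVal_liftRule h c a (y :: l))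

theorem trailVal_map {G H : Type} [Group G] [Group H] (ψ : G →* H) {r : ℕ}
    (c : (Fin D → ℤ) → (ballZ D r → A) → G) (a : Config D A) :
    ∀ ζ : List (Fin D → ℤ), trailVal (fun e p => ψ (c e p)) a ζ = ψ (trailVal c a ζ)
  | [] => (map_one ψ).symm
  | [_] => (map_one ψ).symm
  | x :: y :: l => by simp only [trailVal, map_mul, trailVal_map ψ c a (y :: l)]

/-- The transfer function telescopes along a trail. -/
theorem trailVal_eq_of_transfer {G : Type} [Group G] {𝔄 : Set (Config D A)} {s ρ : ℕ}
    {c₁ c₂ : (Fin D → ℤ) → (ballZ D ρ → A) → G} {b : (ballZ D s → A) → G}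
    (hb : ∀ a : Config D A, ∀ e ∈ stdSteps D, (0 ∈ goodSet 𝔄 ρ a ∧ e ∈ goodSet 𝔄 ρ a) →
      c₂ e (blockAt ρ a 0) = b (blockAt s a e) * c₁ e (blockAt ρ a 0) * (b (blockAt s a 0))⁻¹)
    (a : Config D A) (x : Fin D → ℤ) (l : List (Fin D → ℤ)) (ht : IsTrail (x :: l))
    (hin : TrailIn (goodSet 𝔄 ρ a) (x :: l)) :
    trailVal c₂ a (x :: l) =
      b (blockAt s a ((x :: l).getLast (List.cons_ne_nil x l))) * trailVal c₁ a (x :: l) *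
        (b (blockAt s a x))⁻¹ := by
  induction l generalizing x with
  | nil => simp [trailVal]
  | cons y l ih =>
    obtain ⟨hxy, hl⟩ := List.isChain_cons_cons.mp ht.2
    have hstep := hb (shift x a) (y - x) hxy (by
      simp only [mem_goodSet_shift, zero_add, sub_add_cancel]
      exact ⟨hin x (by simp), hin y (by simp)⟩)
    simp only [blockAt_shift, zero_add, sub_add_cancel] at hstep
    have hy := ih y ⟨List.cons_ne_nil y l, hl⟩ fun z hz => hin z (List.mem_cons_of_mem x hz)
    simp only [trailVal, hy, hstep, List.getLast_cons_cons]
    group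

/-- Locally cohomologous local rules that take values in an abelian group agree on closed
trails. -/
theorem LocallyCohomologous.trailVal_eq {G : Type} [CommGroup G] {𝔄 : Set (Config D A)} {ρ : ℕ}
    {c₁ c₂ : (Fin D → ℤ) → (ballZ D ρ → A) → G} (h : LocallyCohomologous 𝔄 ρ c₁ c₂)
    {a : Config D A} {ζ : List (Fin D → ℤ)} (ht : IsTrail ζ) (hc : IsClosedTrail ζ)
    (hin : TrailIn (goodSet 𝔄 ρ a) ζ) : trailVal c₂ a ζ = trailVal c₁ a ζ := by
  obtain ⟨s, -, b, hb⟩ := h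
  obtain ⟨x, l, rfl⟩ := List.exists_cons_of_ne_nil ht.1
  have hlast : x = (x :: l).getLast (List.cons_ne_nil x l) := by
    simpa [IsClosedTrail, List.getLast?_eq_getLast_of_ne_nil] using hc
  rw [trailVal_eq_of_transfer hb a x l ht hin, ← hlast, mul_right_comm, mul_inv_cancel, one_mul]

theorem statement_12 {D : ℕ} (hD : 1 ≤ D) {A : Type} [Fintype A] [Nonempty A]
    [TopologicalSpace A] [DiscreteTopology A]
    (𝔄 : Set (Config D A)) (h𝔄 : IsSubshift 𝔄)
    {Gs : Type} [CommGroup Gs] (rstar : ℕ)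
    (cstar : (Fin D → ℤ) → (ballZ D rstar → A) → Gs)
    (hstar : IsLocalRule 𝔄 rstar cstar)
    (hfund : IsLocallyFundamental 𝔄 rstar cstar)
    (a : Config D A) (ha : a ∈ almostAdmissible 𝔄)
    (hpole : ∃ (H : Type) (instH : CommGroup H) (rH : ℕ)
        (cH : (Fin D → ℤ) → (ballZ D rH → A) → H),
        @IsLocalRule D A H instH.toGroup 𝔄 rH cH ∧
          @HasProjPole D A H instH.toGroup 𝔄 rH cH a) :
    HasProjPole 𝔄 rstar cstar a := by
  obtain ⟨H, instH, rH, cH, hcH, hp⟩ := hpole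
  obtain ⟨ψ, ρ, h₁, h₂, hcoh⟩ := hfund H rH cH hcH
  intro R hR
  obtain ⟨ζ, ht, hc, hin, hne⟩ := hp (max R ρ) (h₂.trans (le_max_right R ρ))
  refine ⟨ζ, ht, hc, fun z hz => goodSet_antitone 𝔄 a (le_max_left R ρ) (hin z hz),
    fun hone => hne ?_⟩
  have hval := hcoh.trailVal_eq ht hc
    fun z hz => goodSet_antitone 𝔄 a (le_max_right R ρ) (hin z hz)
  rw [trailVal_liftRule, trailVal_liftRule, trailVal_map, hone, map_one] at hval
  exact hval

end Defects
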